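/- arXiv:1208.1690 — 9 statements merged into one kernel-verified Lean document; each statement's English description precedes it below -/
import Mathlib

section
/- For every integer n ≥ 2 and every real r > 0, one has sinh(r)^n > (n−1)·cosh(r)·∫₀^r sinh(t)^{n−1} dt. (Equivalently, the function g(r) = sinh(r)^{−(n−1)}·∫₀^r sinh(t)^{n−1} dt, which satisfies g′ = 1 − (n−1)coth(r)·g, has strictly positive derivative on (0,∞).) -/
theorem hasDerivAt_sinh_pow_succ_div_cosh (m : ℕ) (x : ℝ) :
    HasDerivAt (fun t => Real.sinh t ^ (m + 1) / Real.cosh t)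
      (m * Real.sinh x ^ m + Real.sinh x ^ m / Real.cosh x ^ 2) x := by
  have hc : Real.cosh x ≠ 0 := (Real.cosh_pos x).ne'
  refine (((Real.hasDerivAt_sinh x).fun_pow (m + 1)).fun_div
    (Real.hasDerivAt_cosh x) hc).congr_deriv ?_
  field_simp
  rw [Nat.add_sub_cancel, Real.cosh_sq]
  push_cast
  ring

theorem mul_integral_sinh_pow_lt (m : ℕ) {r : ℝ} (hr : 0 < r) :
    m * ∫ t in (0:ℝ)..r, Real.sinh t ^ m < Real.sinh r ^ (m + 1) / Real.cosh r := by
  have hc : ∀ x, Real.cosh x ^ 2 ≠ 0 := fun x => pow_ne_zero 2 (Real.cosh_pos x).ne'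
  have hcont : Continuous fun x => Real.sinh x ^ m := by fun_prop
  have hcont' : Continuous fun x => Real.sinh x ^ m / Real.cosh x ^ 2 :=
    hcont.div (by fun_prop) hc
  have hint := intervalIntegral.integral_eq_sub_of_hasDerivAt
    (fun x _ => hasDerivAt_sinh_pow_succ_div_cosh m x)
    ((hcont.const_mul (m : ℝ)).add hcont' |>.intervalIntegrable 0 r)
  rw [intervalIntegral.integral_add (hcont.const_mul (m : ℝ) |>.intervalIntegrable 0 r)
    (hcont'.intervalIntegrable 0 r), intervalIntegral.integral_const_mul] at hint
  have hpos : 0 < ∫ x in (0:ℝ)..r, Real.sinh x ^ m / Real.cosh x ^ 2 :=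
    intervalIntegral.intervalIntegral_pos_of_pos_on (hcont'.intervalIntegrable 0 r)
      (fun x hx => div_pos (pow_pos (Real.sinh_pos_iff.2 hx.1) m)
        (pow_pos (Real.cosh_pos x) 2)) hr
  simp only [Real.sinh_zero, zero_pow (Nat.succ_ne_zero m), zero_div, sub_zero] at hint
  linarith

/-- For every integer `n ≥ 2` and every real `r > 0`,
`sinh(r)^n > (n−1)·cosh(r)·∫₀^r sinh(t)^(n−1) dt`. -/
theorem sinh_pow_gt_mul_integral (n : ℕ) (hn : 2 ≤ n) (r : ℝ) (hr : 0 < r) :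
    Real.sinh r ^ n >
      ((n : ℝ) - 1) * Real.cosh r * ∫ t in (0:ℝ)..r, Real.sinh t ^ (n - 1) := by
  obtain ⟨m, rfl⟩ : ∃ m, n = m + 1 := ⟨n - 1, by omega⟩
  have h := (lt_div_iff₀ (Real.cosh_pos r)).1 (mul_integral_sinh_pow_lt m hr)
  simp only [Nat.add_sub_cancel, Nat.cast_add, Nat.cast_one, add_sub_cancel_right]
  linarith
end

section
/- For every integer n ≥ 2 and every real r > 0, one has cosh(r)·sinh(r)^{n−2} > (n−1)·∫₀^r sinh(t)^{n−1} dt. -/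
/-- Reduction formula for the integral of a power of `sinh` from `0`. -/
theorem cosh_mul_sinh_pow_eq_integral_add (k : ℕ) (r : ℝ) :
    Real.cosh r * Real.sinh r ^ (k + 1) =
      ((k : ℝ) + 2) * (∫ t in (0:ℝ)..r, Real.sinh t ^ (k + 2)) +
        ((k : ℝ) + 1) * ∫ t in (0:ℝ)..r, Real.sinh t ^ k := by
  have hint (c : ℝ) (j : ℕ) :
      IntervalIntegrable (fun t => c * Real.sinh t ^ j) MeasureTheory.volume 0 r :=
    (continuous_const.mul (Real.continuous_sinh.pow j)).intervalIntegrable 0 r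
  have hderiv (t : ℝ) : HasDerivAt (fun t => Real.cosh t * Real.sinh t ^ (k + 1))
      (((k : ℝ) + 2) * Real.sinh t ^ (k + 2) + ((k : ℝ) + 1) * Real.sinh t ^ k) t := by
    refine ((Real.hasDerivAt_cosh t).mul ((Real.hasDerivAt_sinh t).pow (k + 1))).congr_deriv ?_
    simp only [Nat.add_sub_cancel, Pi.pow_apply]
    push_cast
    linear_combination ((k : ℝ) + 1) * Real.sinh t ^ k * Real.cosh_sq t
  have hftc := intervalIntegral.integral_eq_sub_of_hasDerivAt (fun t _ => hderiv t)
    ((hint _ _).add (hint _ _))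
  rw [intervalIntegral.integral_add (hint _ _) (hint _ _),
    intervalIntegral.integral_const_mul, intervalIntegral.integral_const_mul] at hftc
  simpa using hftc.symm

/-- For every integer `n ≥ 2` and every real `r > 0`,
`cosh(r)·sinh(r)^(n−2) > (n−1)·∫₀^r sinh(t)^(n−1) dt`. -/
theorem cosh_mul_sinh_pow_gt_integral (n : ℕ) (hn : 2 ≤ n) (r : ℝ) (hr : 0 < r) :
    Real.cosh r * Real.sinh r ^ (n - 2) >
      ((n : ℝ) - 1) * ∫ t in (0:ℝ)..r, Real.sinh t ^ (n - 1) := by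
  obtain ⟨m, rfl⟩ := Nat.exists_eq_add_of_le' hn
  cases m with
  | zero =>
    have h : ∫ t in (0:ℝ)..r, Real.sinh t = Real.cosh r - Real.cosh 0 :=
      intervalIntegral.integral_eq_sub_of_hasDerivAt (fun t _ => Real.hasDerivAt_cosh t)
        (Real.continuous_sinh.intervalIntegrable 0 r)
    norm_num [h]
  | succ k =>
    have hpos : 0 < ∫ t in (0:ℝ)..r, Real.sinh t ^ k :=
      intervalIntegral.intervalIntegral_pos_of_pos_on
        ((Real.continuous_sinh.pow k).intervalIntegrable 0 r)
        (fun t ht => pow_pos (Real.sinh_pos_iff.2 ht.1) k) hr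
    have hcoef : ((k + 1 + 2 : ℕ) : ℝ) - 1 = (k : ℝ) + 2 := by push_cast; ring
    rw [hcoef, show k + 1 + 2 - 2 = k + 1 by omega, show k + 1 + 2 - 1 = k + 2 by omega,
      cosh_mul_sinh_pow_eq_integral_add]
    exact lt_add_of_pos_right _ (by positivity)
end

section
/- For every integer n ≥ 2 and every real r > 0, one has sinh(r)^n·cosh(r) ≥ (n + (n−1)·sinh(r)²)·∫₀^r sinh(t)^{n−1} dt. (Equivalently, the function g(r) = sinh(r)^{−(n−1)}·∫₀^r sinh(t)^{n−1} dt satisfies g″(r) ≤ 0 for all r > 0.) -/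
/-- The quotient `sinh^(m+1)·cosh / (m + 1 + m·sinh²)` has derivative
`sinh^m + 2·sinh^(m+2) / (m + 1 + m·sinh²)²`. -/
theorem hasDerivAt_sinh_pow_mul_cosh_div (m : ℕ) (x : ℝ) :
    HasDerivAt
      (fun t : ℝ => Real.sinh t ^ (m + 1) * Real.cosh t / ((m : ℝ) + 1 + m * Real.sinh t ^ 2))
      (Real.sinh x ^ m +
        Real.sinh x ^ m * (2 * Real.sinh x ^ 2) / ((m : ℝ) + 1 + m * Real.sinh x ^ 2) ^ 2) x := by
  have hD : (m : ℝ) + 1 + m * Real.sinh x ^ 2 ≠ 0 := by positivity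
  have h := (((Real.hasDerivAt_sinh x).pow (m + 1)).mul (Real.hasDerivAt_cosh x)).div
    ((((Real.hasDerivAt_sinh x).pow 2).const_mul (m : ℝ)).const_add ((m : ℝ) + 1)) hD
  refine h.congr_deriv ?_
  simp only [Pi.pow_apply, Pi.mul_apply, Nat.add_sub_cancel]
  push_cast
  field_simp
  linear_combination (Real.sinh x ^ m * (((m : ℝ) + 1) * (m + 1 + m * Real.sinh x ^ 2)
    - 2 * m * Real.sinh x ^ 2)) * Real.cosh_sq x

/-- For every integer `n ≥ 2` and every real `r > 0`,
`sinh(r)^n·cosh(r) ≥ (n + (n−1)·sinh(r)²)·∫₀^r sinh(t)^(n−1) dt`. -/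
theorem sinh_pow_mul_cosh_ge (n : ℕ) (hn : 2 ≤ n) (r : ℝ) (hr : 0 < r) :
    Real.sinh r ^ n * Real.cosh r ≥
      ((n : ℝ) + ((n : ℝ) - 1) * Real.sinh r ^ 2) * ∫ t in (0:ℝ)..r, Real.sinh t ^ (n - 1) := by
  obtain ⟨m, rfl⟩ : ∃ m, n = m + 1 := ⟨n - 1, by omega⟩
  have hD : 0 < (m : ℝ) + 1 + m * Real.sinh r ^ 2 := by positivity
  have h := intervalIntegral.integral_le_sub_of_hasDeriv_right_of_le hr.le
    (fun x _ => (hasDerivAt_sinh_pow_mul_cosh_div m x).continuousAt.continuousWithinAt)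
    (fun x _ => (hasDerivAt_sinh_pow_mul_cosh_div m x).hasDerivWithinAt)
    (Real.continuous_sinh.pow m).continuousOn.integrableOn_Icc
    (fun x hx => by
      have : 0 < Real.sinh x := Real.sinh_pos_iff.2 hx.1
      exact le_add_of_nonneg_right (by positivity))
  simp only [Real.sinh_zero, ne_eq, Nat.add_eq_zero_iff, one_ne_zero, and_false,
    not_false_eq_true, zero_pow, zero_mul, zero_div, sub_zero] at h
  rw [le_div_iff₀ hD, mul_comm] at h
  simpa using h
end

section
/- Let n ≥ 2 be an integer and define g : (0,∞) → ℝ by g(r) = sinh(r)^{−(n−1)}·∫₀^r sinh(t)^{n−1} dt. Then g is strictly increasing on (0,∞). -/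
theorem hasDerivAt_integral_sinh_pow (m : ℕ) (r : ℝ) :
    HasDerivAt (fun x => ∫ t in (0:ℝ)..x, Real.sinh t ^ m) (Real.sinh r ^ m) r := by
  have hc : Continuous fun t : ℝ => Real.sinh t ^ m := Real.continuous_sinh.pow m
  exact hc.integral_hasStrictDerivAt 0 r |>.hasDerivAt

/-- The difference `sinh ^ (m + 1) / cosh - m ∫ sinh ^ m` vanishes at `0` and has derivative
`sinh ^ m / cosh ^ 2`. -/
theorem mul_cosh_mul_integral_sinh_pow_lt (m : ℕ) {r : ℝ} (hr : 0 < r) :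
    m * Real.cosh r * (∫ t in (0:ℝ)..r, Real.sinh t ^ m) < Real.sinh r ^ (m + 1) := by
  have hderiv (x : ℝ) :
      HasDerivAt (fun x => Real.sinh x ^ (m + 1) / Real.cosh x
        - m * ∫ t in (0:ℝ)..x, Real.sinh t ^ m) (Real.sinh x ^ m / Real.cosh x ^ 2) x := by
    have hcosh := (Real.cosh_pos x).ne'
    refine ((((Real.hasDerivAt_sinh x).pow (m + 1)).div (Real.hasDerivAt_cosh x) hcosh).sub
      ((hasDerivAt_integral_sinh_pow m x).const_mul (m : ℝ))).congr_deriv ?_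
    simp only [Nat.add_sub_cancel, Pi.pow_apply]
    push_cast
    field_simp
    linear_combination Real.sinh x ^ m * Real.cosh_sq x
  have hmono := strictMonoOn_of_deriv_pos (convex_Ici (0 : ℝ))
    (fun x _ => (hderiv x).continuousAt.continuousWithinAt) fun x hx => by
      rw [interior_Ici, Set.mem_Ioi] at hx
      rw [(hderiv x).deriv]
      have := Real.sinh_pos_iff.2 hx
      have := Real.cosh_pos x
      positivity
  have h := hmono Set.self_mem_Ici hr.le hr
  simp only [Real.sinh_zero, intervalIntegral.integral_same, ne_eq, Nat.succ_ne_zero,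
    not_false_eq_true, zero_pow, zero_div, mul_zero, sub_zero] at h
  rw [sub_pos, lt_div_iff₀ (Real.cosh_pos r)] at h
  linarith

/-- Let `n ≥ 2` and `g(r) = sinh(r)^{-(n-1)}·∫₀^r sinh(t)^(n-1) dt`.
Then `g` is strictly increasing on `(0,∞)`. -/
theorem radial_steklov_solution_strictMonoOn (n : ℕ) (hn : 2 ≤ n) (g : ℝ → ℝ)
    (hg : ∀ r, 0 < r →
      g r = (∫ t in (0:ℝ)..r, Real.sinh t ^ (n - 1)) / Real.sinh r ^ (n - 1)) :
    StrictMonoOn g (Set.Ioi 0) := by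
  obtain ⟨k, rfl⟩ := Nat.exists_eq_add_of_le' hn
  have hk : k + 2 - 1 = k + 1 := rfl
  simp only [hk] at hg
  have hderiv (x : ℝ) (hx : 0 < x) :=
    (hasDerivAt_integral_sinh_pow (k + 1) x).div ((Real.hasDerivAt_sinh x).pow (k + 1))
      (pow_pos (Real.sinh_pos_iff.2 hx) (k + 1)).ne'
  refine StrictMonoOn.congr (strictMonoOn_of_deriv_pos (convex_Ioi (0 : ℝ))
    (fun x hx => (hderiv x hx).continuousAt.continuousWithinAt) fun x hx => ?_)
    fun x hx => (hg x hx).symm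
  rw [interior_Ioi, Set.mem_Ioi] at hx
  rw [(hderiv x hx).deriv]
  have hs := Real.sinh_pos_iff.2 hx
  have h := mul_cosh_mul_integral_sinh_pow_lt (k + 1) hx
  simp only [Nat.add_sub_cancel, Pi.pow_apply]
  refine div_pos ?_ (by positivity)
  have := mul_pos (pow_pos hs k) (sub_pos.2 h)
  convert this using 1
  ring
end

section
/- Let n ≥ 2 be an integer and define g : (0,∞) → ℝ by g(r) = sinh(r)^{−(n−1)}·∫₀^r sinh(t)^{n−1} dt. Then the function r ↦ (n−1)·g(r)²/sinh(r)² + g′(r)² is nonincreasing (antitone) on (0,∞). -/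
/-- The quotient `g = (∫₀^r sinh^m) / sinh^m` solves `g' + m coth(r) g = 1` on `(0,∞)`. -/
lemma hasDerivAt_of_eq_integral_sinh_pow_div (m : ℕ) (g : ℝ → ℝ)
    (hg : ∀ r, 0 < r → g r = (∫ t in (0:ℝ)..r, Real.sinh t ^ m) / Real.sinh r ^ m)
    {r : ℝ} (hr : 0 < r) :
    HasDerivAt g (1 - m * (Real.cosh r / Real.sinh r) * g r) r := by
  have hs : Real.sinh r ≠ 0 := (Real.sinh_pos_iff.2 hr).ne'
  have hc : Continuous fun t : ℝ => Real.sinh t ^ m := by fun_prop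
  have hI : HasDerivAt (fun r => ∫ t in (0:ℝ)..r, Real.sinh t ^ m) (Real.sinh r ^ m) r :=
    hc.integral_hasStrictDerivAt 0 r |>.hasDerivAt
  have hq := hI.fun_div ((Real.hasDerivAt_sinh r).fun_pow m) (pow_ne_zero m hs)
  have he : g =ᶠ[nhds r]
      fun r => (∫ t in (0:ℝ)..r, Real.sinh t ^ m) / Real.sinh r ^ m := by
    filter_upwards [Ioi_mem_nhds hr] with x hx using hg x hx
  refine (hq.congr_of_eventuallyEq he).congr_deriv ?_
  rw [hg r hr]
  rcases m with _ | k
  · simp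
  · simp only [Nat.add_sub_cancel]
    field_simp
    ring

/-- Along solutions of `g' + m coth(r) g = 1`, the function `m g² / sinh² + g'²` has derivative
minus `2m / sinh` times a quadratic form in `(g / sinh, g')`. -/
lemma hasDerivAt_steklov_integrand (m : ℝ) (g : ℝ → ℝ) {r : ℝ} (hr : 0 < r)
    (hg : HasDerivAt g (1 - m * (Real.cosh r / Real.sinh r) * g r) r) :
    HasDerivAt
      (fun r => m * g r ^ 2 / Real.sinh r ^ 2
        + (1 - m * (Real.cosh r / Real.sinh r) * g r) ^ 2)
      (-(2 * m / Real.sinh r) *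
        (Real.cosh r * (g r / Real.sinh r) ^ 2
          - 2 * (g r / Real.sinh r) * (1 - m * (Real.cosh r / Real.sinh r) * g r)
          + Real.cosh r * (1 - m * (Real.cosh r / Real.sinh r) * g r) ^ 2)) r := by
  have hs : Real.sinh r ≠ 0 := (Real.sinh_pos_iff.2 hr).ne'
  have hcoth := (Real.hasDerivAt_cosh r).fun_div (Real.hasDerivAt_sinh r) hs
  have h₁ := ((hg.fun_pow 2).const_mul m).fun_div ((Real.hasDerivAt_sinh r).fun_pow 2)
    (pow_ne_zero 2 hs)
  have h₂ := (((hcoth.const_mul m).fun_mul hg).const_sub 1).fun_pow 2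
  refine (h₁.fun_add h₂).congr_deriv ?_
  have hcs : Real.sinh r * Real.sinh r - Real.cosh r * Real.cosh r = -1 := by
    linarith [Real.cosh_sq r]
  simp only [hcs, Nat.reduceSub, pow_one, Nat.cast_ofNat]
  field_simp
  ring

/-- Let `n ≥ 2` and `g(r) = sinh(r)^{-(n-1)}·∫₀^r sinh(t)^(n-1) dt`.
Then `r ↦ (n−1)·g(r)²/sinh(r)² + g′(r)²` is nonincreasing on `(0,∞)`. -/
theorem steklov_integrand_antitoneOn (n : ℕ) (hn : 2 ≤ n) (g : ℝ → ℝ)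
    (hg : ∀ r, 0 < r →
      g r = (∫ t in (0:ℝ)..r, Real.sinh t ^ (n - 1)) / Real.sinh r ^ (n - 1)) :
    AntitoneOn
      (fun r => ((n : ℝ) - 1) * g r ^ 2 / Real.sinh r ^ 2 + (deriv g r) ^ 2)
      (Set.Ioi 0) := by
  have hcast : ((n - 1 : ℕ) : ℝ) = (n : ℝ) - 1 := by
    rw [Nat.cast_sub (by omega), Nat.cast_one]
  have hm : (0 : ℝ) ≤ (n : ℝ) - 1 := hcast ▸ Nat.cast_nonneg _
  have hg' : ∀ r, 0 < r →
      HasDerivAt g (1 - ((n : ℝ) - 1) * (Real.cosh r / Real.sinh r) * g r) r := fun r hr =>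
    hcast ▸ hasDerivAt_of_eq_integral_sinh_pow_div (n - 1) g hg hr
  have hF := fun r (hr : 0 < r) => hasDerivAt_steklov_integrand _ g hr (hg' r hr)
  refine AntitoneOn.congr (f₁ := fun r => ((n : ℝ) - 1) * g r ^ 2 / Real.sinh r ^ 2
    + (1 - ((n : ℝ) - 1) * (Real.cosh r / Real.sinh r) * g r) ^ 2) ?_ ?_
  · refine antitoneOn_of_deriv_nonpos (convex_Ioi 0)
      (fun r hr => (hF r hr).continuousAt.continuousWithinAt) ?_ ?_
    · rw [interior_Ioi]
      exact fun r hr => (hF r hr).differentiableAt.differentiableWithinAt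
    · rw [interior_Ioi]
      intro r hr
      have hs : 0 < Real.sinh r := Real.sinh_pos_iff.2 hr
      rw [(hF r hr).deriv, neg_mul]
      refine neg_nonpos.2 (mul_nonneg (by positivity) ?_)
      generalize g r / Real.sinh r = a
      generalize 1 - ((n : ℝ) - 1) * (Real.cosh r / Real.sinh r) * g r = b
      nlinarith [sq_nonneg (a - b),
        mul_nonneg (sub_nonneg.2 (Real.one_le_cosh r)) (add_nonneg (sq_nonneg a) (sq_nonneg b))]
  · intro r hr
    simp only [(hg' r hr).deriv]
end

section
/- Let k and n be integers with either (k = 2 and n ≥ 2), (k = 4 and n ≥ 2), or (k = 8 and n = 2). Define φ(r) = sinh(r)^{kn−1}·cosh(r)^{k−1} and g(r) = φ(r)^{−1}·∫₀^r φ(t) dt for r > 0. Then the function r ↦ ((kn−1)/sinh(r)² − (k−1)/cosh(r)²)·g(r)² + g′(r)² is nonincreasing (antitone) on (0,∞). -/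
lemma hasDerivAt_sinh_pow_mul_cosh_pow (p q : ℕ) {r : ℝ} (hr : 0 < r) :
    HasDerivAt (fun t => Real.sinh t ^ p * Real.cosh t ^ q)
      ((p * (Real.cosh r / Real.sinh r) + q * (Real.sinh r / Real.cosh r)) *
        (Real.sinh r ^ p * Real.cosh r ^ q)) r := by
  have hs : Real.sinh r ≠ 0 := (Real.sinh_pos_iff.2 hr).ne'
  have hc : Real.cosh r ≠ 0 := (Real.cosh_pos r).ne'
  have hpow : ∀ (m : ℕ) {x : ℝ}, x ≠ 0 → (m : ℝ) * x ^ (m - 1) = m * x ^ m / x := by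
    intro m x hx
    cases m with
    | zero => simp
    | succ m => field_simp; simp [pow_succ]
  refine (((Real.hasDerivAt_sinh r).pow p).mul ((Real.hasDerivAt_cosh r).pow q)).congr_deriv ?_
  simp only [hpow p hs, hpow q hc, Pi.pow_apply]
  field_simp

lemma hasDerivAt_integral_div_self {φ : ℝ → ℝ} (hφ : Continuous φ) {r h : ℝ} (hr : φ r ≠ 0)
    (hderiv : HasDerivAt φ (h * φ r) r) :
    HasDerivAt (fun x => (∫ t in (0 : ℝ)..x, φ t) / φ x)
      (1 - h * ((∫ t in (0 : ℝ)..r, φ t) / φ r)) r := by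
  refine ((hφ.integral_hasStrictDerivAt 0 r).hasDerivAt.div hderiv hr).congr_deriv ?_
  field_simp

lemma steklov_quadratic_form_nonpos {a b s c x y : ℝ} (hb : 0 ≤ b) (hab : b ≤ a) (hs : 0 < s)
    (hc : 0 < c) (hcs : c ^ 2 = s ^ 2 + 1) :
    (2 * b * s / c ^ 3 - 2 * a * c / s ^ 3) * x ^ 2 + 4 * (a / s ^ 2 - b / c ^ 2) * x * y
      - 2 * (a * (c / s) + b * (s / c)) * y ^ 2 ≤ 0 := by
  set h := a * (c / s) + b * (s / c) with hh
  set l := a / s ^ 2 - b / c ^ 2 with hl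
  set m := 2 * b * s / c ^ 3 - 2 * a * c / s ^ 3 with hm
  have ha : 0 ≤ a := hb.trans hab
  rcases ha.eq_or_lt with rfl | ha
  · obtain rfl : b = 0 := le_antisymm hab hb
    simp [hh, hl, hm]
  have hpos : 0 < h := by positivity
  have hdisc : 0 ≤ -(h * m) - 2 * l ^ 2 := by
    have key : -(h * m) - 2 * l ^ 2
        = 2 * (a ^ 2 * c ^ 2 + 3 * a * b - b ^ 2 * s ^ 2) / (s ^ 2 * c ^ 2) := by
      rw [hh, hl, hm]
      field_simp
      have h4 : c ^ 4 = (s ^ 2 + 1) ^ 2 := by rw [← hcs]; ring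
      have h6 : c ^ 6 = (s ^ 2 + 1) ^ 3 := by rw [← hcs]; ring
      ring_nf
      simp only [hcs, h4, h6]
      ring
    rw [key]
    have : b ^ 2 ≤ a ^ 2 := by gcongr
    have : 0 ≤ a ^ 2 * c ^ 2 + 3 * a * b - b ^ 2 * s ^ 2 := by
      rw [hcs]
      nlinarith [mul_nonneg ha.le hb, mul_nonneg (sub_nonneg.2 this) (sq_nonneg s), sq_nonneg a]
    positivity
  refine nonpos_of_mul_nonpos_right (a := h) ?_ hpos
  nlinarith [mul_nonneg hdisc (sq_nonneg x), sq_nonneg (h * y - l * x)]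

lemma antitoneOn_of_hasDerivAt_steklov {a b : ℝ} (hb : 0 ≤ b) (hab : b ≤ a) {g : ℝ → ℝ}
    (hg : ∀ r, 0 < r → HasDerivAt g
      (1 - (a * (Real.cosh r / Real.sinh r) + b * (Real.sinh r / Real.cosh r)) * g r) r) :
    AntitoneOn
      (fun r => (a / Real.sinh r ^ 2 - b / Real.cosh r ^ 2) * g r ^ 2 + (deriv g r) ^ 2)
      (Set.Ioi 0) := by
  set F : ℝ → ℝ := fun r => (a / Real.sinh r ^ 2 - b / Real.cosh r ^ 2) * g r ^ 2 +
    (1 - (a * (Real.cosh r / Real.sinh r) + b * (Real.sinh r / Real.cosh r)) * g r) ^ 2 with hF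
  have hderiv : ∀ r, 0 < r → ∃ d ≤ 0, HasDerivAt F d r := by
    intro r hr
    have hs : 0 < Real.sinh r := Real.sinh_pos_iff.2 hr
    have hc : 0 < Real.cosh r := Real.cosh_pos r
    have hS := Real.hasDerivAt_sinh r
    have hC := Real.hasDerivAt_cosh r
    have hl := ((hasDerivAt_const r a).fun_div (hS.fun_pow 2) (by positivity)).fun_sub
      ((hasDerivAt_const r b).fun_div (hC.fun_pow 2) (by positivity))
    have hh := ((hC.fun_div hS hs.ne').const_mul a).fun_add ((hS.fun_div hC hc.ne').const_mul b)
    have hd := (hl.fun_mul ((hg r hr).fun_pow 2)).fun_add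
      (((hh.fun_mul (hg r hr)).const_sub 1).fun_pow 2)
    refine ⟨_, steklov_quadratic_form_nonpos (x := g r)
      (y := 1 - (a * (Real.cosh r / Real.sinh r) + b * (Real.sinh r / Real.cosh r)) * g r)
      hb hab hs hc (Real.cosh_sq r), hd.congr_deriv ?_⟩
    have hcoth : (Real.sinh r * Real.sinh r - Real.cosh r * Real.cosh r) / Real.sinh r ^ 2
        = -(1 / Real.sinh r ^ 2) := by
      rw [← neg_div]; congr 1; linarith [Real.cosh_sq r]
    have htanh : (Real.cosh r * Real.cosh r - Real.sinh r * Real.sinh r) / Real.cosh r ^ 2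
        = 1 / Real.cosh r ^ 2 := by
      congr 1; linarith [Real.cosh_sq r]
    rw [hcoth, htanh]
    generalize 1 - (a * (Real.cosh r / Real.sinh r) + b * (Real.sinh r / Real.cosh r)) * g r = y
    field_simp
    ring
  have hanti : AntitoneOn F (Set.Ioi 0) := by
    refine antitoneOn_of_deriv_nonpos (convex_Ioi 0) ?_ ?_ ?_
    · intro r hr
      obtain ⟨d, -, hd⟩ := hderiv r hr
      exact hd.continuousAt.continuousWithinAt
    · intro r hr
      rw [interior_Ioi] at hr
      obtain ⟨d, -, hd⟩ := hderiv r hr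
      exact hd.differentiableAt.differentiableWithinAt
    · intro r hr
      rw [interior_Ioi] at hr
      obtain ⟨d, hd0, hd⟩ := hderiv r hr
      rwa [hd.deriv]
  refine hanti.congr fun r hr => ?_
  simp only [hF, (hg r hr).deriv]

/-- For the noncompact rank-1 symmetric spaces `ℂHⁿ` (k = 2), `ℍHⁿ` (k = 4) and
`ℂaH²` (k = 8, n = 2), with volume density `φ(r) = sinh(r)^(kn-1)·cosh(r)^(k-1)`
and radial Steklov solution `g = (∫₀^r φ)/φ`, the function
`r ↦ ((kn−1)/sinh(r)² − (k−1)/cosh(r)²)·g(r)² + g′(r)²` is nonincreasing on `(0,∞)`. -/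
theorem steklov_integrand_antitoneOn_rank_one (k n : ℕ)
    (hkn : (k = 2 ∧ 2 ≤ n) ∨ (k = 4 ∧ 2 ≤ n) ∨ (k = 8 ∧ n = 2))
    (φ g : ℝ → ℝ)
    (hφ : ∀ r, φ r = Real.sinh r ^ (k * n - 1) * Real.cosh r ^ (k - 1))
    (hg : ∀ r, 0 < r → g r = (∫ t in (0:ℝ)..r, φ t) / φ r) :
    AntitoneOn
      (fun r =>
        ((((k * n : ℕ) : ℝ) - 1) / Real.sinh r ^ 2 - ((k : ℝ) - 1) / Real.cosh r ^ 2)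
          * g r ^ 2 + (deriv g r) ^ 2)
      (Set.Ioi 0) := by
  have hk : 1 ≤ k := by omega
  have hn : 1 ≤ n := by omega
  have hkle : k ≤ k * n := Nat.le_mul_of_pos_right k hn
  rw [← Nat.cast_pred (R := ℝ) (by omega : 0 < k * n), ← Nat.cast_pred (R := ℝ) hk]
  refine antitoneOn_of_hasDerivAt_steklov (Nat.cast_nonneg _)
    (Nat.cast_le.2 (Nat.sub_le_sub_right hkle 1)) fun r hr => ?_
  obtain rfl := funext hφ
  have hs : 0 < Real.sinh r := Real.sinh_pos_iff.2 hr
  have hc : 0 < Real.cosh r := Real.cosh_pos r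
  have hG := hasDerivAt_integral_div_self (by fun_prop) (by positivity)
    (hasDerivAt_sinh_pow_mul_cosh_pow (k * n - 1) (k - 1) hr)
  rw [hg r hr]
  exact hG.congr_of_eventuallyEq ((lt_mem_nhds hr).mono hg)
end

section
/- Let k and n be integers with n ≥ 2 and k ∈ {1, 2, 4, 8}, and with n = 2 when k = 8. Define φ(r) = sinh(r)^{kn−1}·cosh(r)^{k−1}, T(r) = (kn−1)·coth(r) + (k−1)·tanh(r), and g(r) = φ(r)^{−1}·∫₀^r φ(t) dt for r > 0. Then the function f(r) = 2·g(r) − T(r)·g(r)² is strictly increasing on (0,∞). -/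
open Real

theorem hasDerivAt_sinh_pow_mul_cosh_pow_s10 (a b : ℕ) {r : ℝ} (hr : 0 < r) :
    HasDerivAt (fun r => sinh r ^ a * cosh r ^ b)
      ((a * (cosh r / sinh r) + b * tanh r) * (sinh r ^ a * cosh r ^ b)) r := by
  have hs : sinh r ≠ 0 := (sinh_pos_iff.2 hr).ne'
  have hc : cosh r ≠ 0 := (cosh_pos r).ne'
  refine HasDerivAt.congr_deriv (((hasDerivAt_sinh r).pow a).mul ((hasDerivAt_cosh r).pow b)) ?_
  rw [tanh_eq_sinh_div_cosh]
  rcases a with _ | a <;> rcases b with _ | b <;>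
    simp only [Pi.pow_apply, Nat.cast_zero, Nat.add_sub_cancel] <;> field_simp <;> ring

theorem hasDerivAt_coth_add_tanh (a b : ℝ) {r : ℝ} (hr : 0 < r) :
    HasDerivAt (fun r => a * (cosh r / sinh r) + b * tanh r)
      (-(a / sinh r ^ 2 - b / cosh r ^ 2)) r := by
  have hs : sinh r ≠ 0 := (sinh_pos_iff.2 hr).ne'
  have hc : cosh r ≠ 0 := (cosh_pos r).ne'
  rw [funext tanh_eq_sinh_div_cosh]
  refine HasDerivAt.congr_deriv ((((hasDerivAt_cosh r).div (hasDerivAt_sinh r) hs).const_mul a).add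
    (((hasDerivAt_sinh r).div (hasDerivAt_cosh r) hc).const_mul b)) ?_
  have h := cosh_sq r
  rw [show sinh r * sinh r - cosh r * cosh r = -1 by linarith,
    show cosh r * cosh r - sinh r * sinh r = 1 by linarith]
  ring

theorem div_sinh_sq_sub_div_cosh_sq_pos {a b : ℝ} (hb : 0 ≤ b) (hab : b < a) {r : ℝ}
    (hr : 0 < r) : 0 < a / sinh r ^ 2 - b / cosh r ^ 2 := by
  have hs : 0 < sinh r ^ 2 := pow_pos (sinh_pos_iff.2 hr) 2
  have hsc : sinh r ^ 2 ≤ cosh r ^ 2 := by linarith [cosh_sq r]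
  have h1 : b / cosh r ^ 2 ≤ b / sinh r ^ 2 := div_le_div_of_nonneg_left hb hs hsc
  have h2 : b / sinh r ^ 2 < a / sinh r ^ 2 := div_lt_div_of_pos_right hab hs
  linarith

/-- If `φ' = T φ`, then `g = (∫₀^r φ) / φ` solves `g' = 1 - T g`. -/
theorem hasDerivAt_integral_div {φ : ℝ → ℝ} (hφ : Continuous φ) {τ r : ℝ}
    (hd : HasDerivAt φ (τ * φ r) r) (h0 : φ r ≠ 0) :
    HasDerivAt (fun r => (∫ t in (0 : ℝ)..r, φ t) / φ r)
      (1 - τ * ((∫ t in (0 : ℝ)..r, φ t) / φ r)) r := by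
  refine HasDerivAt.congr_deriv ((hφ.integral_hasStrictDerivAt 0 r).hasDerivAt.div hd h0) ?_
  field_simp

theorem hasDerivAt_two_mul_sub_mul_sq {T g : ℝ → ℝ} {T' r : ℝ} (hT : HasDerivAt T T' r)
    (hg : HasDerivAt g (1 - T r * g r) r) :
    HasDerivAt (fun r => 2 * g r - T r * g r ^ 2)
      (g r ^ 2 * -T' + 2 * (1 - T r * g r) ^ 2) r := by
  refine HasDerivAt.congr_deriv ((hg.const_mul 2).sub (hT.mul (hg.pow 2))) ?_
  ring

/-- For the noncompact rank-1 symmetric spaces (`k ∈ {1,2,4,8}`, `n ≥ 2`, `n = 2`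
when `k = 8`), with volume density `φ(r) = sinh(r)^(kn-1)·cosh(r)^(k-1)`, mean
curvature `T(r) = (kn−1)coth(r) + (k−1)tanh(r)` and radial Steklov solution
`g = (∫₀^r φ)/φ`, the function `f(r) = 2g(r) − T(r)·g(r)²` is strictly
increasing on `(0,∞)`. -/
theorem mean_curvature_test_function_strictMonoOn (k n : ℕ)
    (hk : k = 1 ∨ k = 2 ∨ k = 4 ∨ k = 8) (hn : 2 ≤ n) (hk8 : k = 8 → n = 2)
    (φ T g f : ℝ → ℝ)
    (hφ : ∀ r, φ r = Real.sinh r ^ (k * n - 1) * Real.cosh r ^ (k - 1))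
    (hT : ∀ r, T r = (((k * n : ℕ) : ℝ) - 1) * (Real.cosh r / Real.sinh r)
        + ((k : ℝ) - 1) * Real.tanh r)
    (hg : ∀ r, 0 < r → g r = (∫ t in (0:ℝ)..r, φ t) / φ r)
    (hf : ∀ r, f r = 2 * g r - T r * g r ^ 2) :
    StrictMonoOn f (Set.Ioi 0) := by
  have hk1 : 1 ≤ k := by omega
  have hkn : k < k * n := by nlinarith
  have hφ' : φ = fun r => sinh r ^ (k * n - 1) * cosh r ^ (k - 1) := funext hφ
  have hT' : T = fun r => (((k * n : ℕ) : ℝ) - 1) * (cosh r / sinh r)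
      + ((k : ℝ) - 1) * tanh r := funext hT
  have hcont : Continuous φ := by rw [hφ']; fun_prop
  have hpos : ∀ r, 0 < r → 0 < φ r := fun r hr => by
    rw [hφ]
    exact mul_pos (pow_pos (sinh_pos_iff.2 hr) _) (pow_pos (cosh_pos r) _)
  have hdφ : ∀ r, 0 < r → HasDerivAt φ (T r * φ r) r := fun r hr => by
    have h := hasDerivAt_sinh_pow_mul_cosh_pow_s10 (k * n - 1) (k - 1) hr
    rw [Nat.cast_sub (hk1.trans hkn.le), Nat.cast_sub hk1, Nat.cast_one] at h
    rw [hT, hφ r, hφ']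
    exact h
  have hdg : ∀ r, 0 < r → HasDerivAt g (1 - T r * g r) r := fun r hr => by
    rw [hg r hr]
    refine (hasDerivAt_integral_div hcont (hdφ r hr) (hpos r hr).ne').congr_of_eventuallyEq ?_
    filter_upwards [Ioi_mem_nhds hr] with x hx using hg x hx
  have hdf : ∀ r, 0 < r → HasDerivAt f (g r ^ 2 *
      -(-((((k * n : ℕ) : ℝ) - 1) / sinh r ^ 2 - ((k : ℝ) - 1) / cosh r ^ 2))
        + 2 * (1 - T r * g r) ^ 2) r := fun r hr => by
    rw [funext hf]
    refine hasDerivAt_two_mul_sub_mul_sq ?_ (hdg r hr)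
    rw [hT']
    exact hasDerivAt_coth_add_tanh _ _ hr
  refine strictMonoOn_of_deriv_pos (convex_Ioi 0)
    (fun r hr => (hdf r hr).continuousAt.continuousWithinAt) fun r hr => ?_
  rw [interior_Ioi] at hr
  rw [(hdf r hr).deriv, neg_neg]
  have hgpos : 0 < g r := by
    rw [hg r hr]
    exact div_pos (intervalIntegral.intervalIntegral_pos_of_pos_on
      (hcont.intervalIntegrable 0 r) (fun x hx => hpos x hx.1) hr) (hpos r hr)
  have hk1' : (1 : ℝ) ≤ k := by exact_mod_cast hk1
  have hkn' : (k : ℝ) < (k * n : ℕ) := by exact_mod_cast hkn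
  have hlam : 0 < (((k * n : ℕ) : ℝ) - 1) / sinh r ^ 2 - ((k : ℝ) - 1) / cosh r ^ 2 :=
    div_sinh_sq_sub_div_cosh_sq_pos (by linarith) (by linarith) hr
  positivity
end

section
/- Let n ≥ 1 be an integer, let A ⊆ ℝⁿ be a compact set of positive Lebesgue measure contained in an open ball B(q₀, c) of radius c > 0, and let G : ℝ → ℝ be continuous on [0, 2c] and strictly positive on (0, 2c). Then there exists a point p in the convex hull of A such that the vector-valued integral ∫_A G(‖x − p‖)·(x − p) dx equals 0 in ℝⁿ. -/
open MeasureTheory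

open Set Filter Topology

/-- In a finite-dimensional space the convex hull of a compact set is compact. -/
lemma isCompact_convexHull_of_isCompact {E : Type*} [NormedAddCommGroup E] [NormedSpace ℝ E]
    [FiniteDimensional ℝ E] {A : Set E} (hA : IsCompact A) : IsCompact (convexHull ℝ A) := by
  have h : convexHull ℝ A = ⋃ k ∈ Iic (Module.finrank ℝ E + 1),
      (fun z : (Fin k → ℝ) × (Fin k → E) ↦ ∑ i, z.1 i • z.2 i) ''
        (stdSimplex ℝ (Fin k) ×ˢ univ.pi fun _ ↦ A) := by
    refine Subset.antisymm (fun x hx ↦ ?_) ?_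
    · obtain ⟨ι, _, z, w, hz, hind, hw, hw1, rfl⟩ := eq_pos_convex_span_of_mem_convexHull hx
      let e := Fintype.equivFin ι
      refine mem_iUnion₂.2 ⟨Fintype.card ι, ?_, (w ∘ e.symm, z ∘ e.symm), ⟨⟨fun i ↦ ?_, ?_⟩, ?_⟩, ?_⟩
      · exact hind.card_le_finrank_succ.trans (by gcongr; exact Submodule.finrank_le _)
      · exact (hw _).le
      · exact (e.symm.sum_comp w).trans hw1
      · exact fun i _ ↦ hz (mem_range_self _)
      · exact e.symm.sum_comp fun i ↦ w i • z i
    · refine iUnion₂_subset fun k _ ↦ ?_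
      rintro _ ⟨⟨w, z⟩, ⟨⟨hw, hw1⟩, hz⟩, rfl⟩
      exact (convex_convexHull ℝ A).sum_mem (fun i _ ↦ hw i) hw1
        fun i _ ↦ subset_convexHull ℝ A (hz i (mem_univ i))
  rw [h]
  exact (finite_Iic _).isCompact_biUnion fun k _ ↦
    ((isCompact_stdSimplex ℝ _).prod (isCompact_univ_pi fun _ ↦ hA)).image (by fun_prop)

section CenterOfMass

variable {E : Type*} [NormedAddCommGroup E]

/-- The radial potential whose gradient at `y` is `2 H(‖y‖) y`. -/
noncomputable def radialPotential (H : ℝ → ℝ) (y : E) : ℝ :=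
  ∫ s in (0 : ℝ)..‖y‖ ^ 2, H (√s)

lemma continuous_radialPotential {H : ℝ → ℝ} (hH : Continuous H) :
    Continuous (radialPotential H : E → ℝ) := by
  have h : Continuous fun u : ℝ ↦ ∫ s in (0 : ℝ)..u, H (√s) :=
    intervalIntegral.continuous_primitive
      (fun a b ↦ (hH.comp Real.continuous_sqrt).intervalIntegrable a b) 0
  exact h.comp (continuous_norm.pow 2)

variable [InnerProductSpace ℝ E]

lemma hasDerivAt_radialPotential_sub_smul {H : ℝ → ℝ} (hH : Continuous H) (y v : E) (t : ℝ) :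
    HasDerivAt (fun t : ℝ ↦ radialPotential H (y - t • v))
      (-2 * inner ℝ (H ‖y - t • v‖ • (y - t • v)) v) t := by
  have h1 : HasDerivAt (fun t : ℝ ↦ y - t • v) (-v) t := by
    simpa using ((hasDerivAt_id t).smul_const v).const_sub y
  have h2 := ((hH.comp Real.continuous_sqrt).integral_hasStrictDerivAt 0
    (‖y - t • v‖ ^ 2)).hasDerivAt
  refine (h2.comp t h1.norm_sq).congr_deriv ?_
  simp only [Function.comp_apply, Real.sqrt_sq (norm_nonneg _), inner_neg_right,
    real_inner_smul_left]
  ring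

variable [FiniteDimensional ℝ E] [MeasurableSpace E] [BorelSpace E]
  {μ : Measure E} [IsLocallyFiniteMeasure μ]

lemma hasDerivAt_setIntegral_radialPotential {H : ℝ → ℝ} (hH : Continuous H) {A : Set E}
    (hA : IsCompact A) (p v : E) :
    HasDerivAt (fun t : ℝ ↦ ∫ x in A, radialPotential H (x - (p + t • v)) ∂μ)
      (-2 * inner ℝ (∫ x in A, H ‖x - p‖ • (x - p) ∂μ) v) 0 := by
  have hcont : Continuous fun z : ℝ × E ↦
      -2 * inner ℝ (H ‖z.2 - p - z.1 • v‖ • (z.2 - p - z.1 • v)) v := by fun_prop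
  obtain ⟨C, hC⟩ := ((isCompact_closedBall (0 : ℝ) 1).prod hA).exists_bound_of_continuousOn
    hcont.continuousOn
  have hpot (t : ℝ) : Continuous fun x : E ↦ radialPotential H (x - (p + t • v)) :=
    (continuous_radialPotential hH).comp (by fun_prop)
  have hfield : IntegrableOn (fun x ↦ H ‖x - p‖ • (x - p)) A μ :=
    Continuous.continuousOn (by fun_prop) |>.integrableOn_compact hA
  have key := (hasDerivAt_integral_of_dominated_loc_of_deriv_le
    (μ := μ.restrict A) (F := fun (t : ℝ) x ↦ radialPotential H (x - (p + t • v)))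
    (F' := fun (t : ℝ) x ↦ -2 * inner ℝ (H ‖x - p - t • v‖ • (x - p - t • v)) v)
    (x₀ := 0) (bound := fun _ ↦ C) (Metric.closedBall_mem_nhds (0 : ℝ) one_pos)
    (Eventually.of_forall fun t ↦ (hpot t).aestronglyMeasurable)
    ((hpot 0).continuousOn.integrableOn_compact hA)
    (hcont.comp (Continuous.prodMk_right 0)).aestronglyMeasurable
    ((ae_restrict_iff' hA.measurableSet).2 <| Eventually.of_forall fun x hx t ht ↦
      hC (t, x) ⟨ht, hx⟩)
    (integrableOn_const hA.measure_lt_top.ne)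
    (Eventually.of_forall fun x t _ ↦ by
      simpa only [sub_add_eq_sub_sub] using
        hasDerivAt_radialPotential_sub_smul hH (x - p) v t)).2
  refine key.congr_deriv ?_
  simp only [zero_smul, sub_zero]
  rw [integral_const_mul, real_inner_comm, ← integral_inner hfield]
  simp only [real_inner_comm]

/-- The average over a compact set `A` of a continuous radial field satisfies the variational
inequality on the convex hull of `A` at some point: a minimizer of the averaged potential. -/
lemma exists_mem_convexHull_inner_setIntegral_nonpos {H : ℝ → ℝ} (hH : Continuous H) {A : Set E}
    (hA : IsCompact A) (hne : A.Nonempty) :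
    ∃ p ∈ convexHull ℝ A, ∀ q ∈ convexHull ℝ A,
      inner ℝ (∫ x in A, H ‖x - p‖ • (x - p) ∂μ) (q - p) ≤ 0 := by
  have hF : Continuous fun p : E ↦ ∫ x in A, radialPotential H (x - p) ∂μ :=
    continuous_parametric_integral_of_continuous
      (f := fun p x ↦ radialPotential H (x - p))
      ((continuous_radialPotential hH).comp (continuous_snd.sub continuous_fst)) hA
  obtain ⟨p, hp, hmin⟩ := (isCompact_convexHull_of_isCompact hA).exists_isMinOn hne.convexHull hF.continuousOn
  refine ⟨p, hp, fun q hq ↦ ?_⟩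
  have hslope :=
    (hasDerivAt_setIntegral_radialPotential (μ := μ) hH hA p (q - p)).tendsto_slope_zero_right
  have hnonneg := ge_of_tendsto hslope (b := 0) <| by
    filter_upwards [Ioo_mem_nhdsGT (zero_lt_one' ℝ)] with t ht
    have hle := hmin ((convex_convexHull ℝ A).add_smul_sub_mem hp hq ⟨ht.1.le, ht.2.le⟩)
    simp only [mem_ofPred_eq] at hle
    simpa using mul_nonneg (inv_nonneg.2 ht.1.le) (sub_nonneg.2 hle)
  linarith

end CenterOfMass

/-- Center of mass lemma: if `A ⊆ ℝⁿ` is a compact set of positive Lebesgue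
measure contained in a ball `B(q₀, c)`, and `G` is continuous on `[0, 2c]` and
strictly positive on `(0, 2c)`, then there is a point `p` in the convex hull of
`A` with `∫_A G(‖x − p‖)·(x − p) dx = 0`. -/
theorem exists_center_of_mass (n : ℕ) (hn : 1 ≤ n) (c : ℝ) (hc : 0 < c)
    (q₀ : EuclideanSpace ℝ (Fin n)) (A : Set (EuclideanSpace ℝ (Fin n)))
    (hA : IsCompact A) (hAsub : A ⊆ Metric.ball q₀ c) (hApos : 0 < volume A)
    (G : ℝ → ℝ) (hGc : ContinuousOn G (Set.Icc 0 (2 * c)))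
    (hGpos : ∀ t ∈ Set.Ioo (0 : ℝ) (2 * c), 0 < G t) :
    ∃ p ∈ convexHull ℝ A, (∫ x in A, G ‖x - p‖ • (x - p)) = 0 := by
  have hc2 : (0 : ℝ) ≤ 2 * c := by positivity
  set H : ℝ → ℝ := IccExtend hc2 ((Icc 0 (2 * c)).domRestrict G)
  have hH : Continuous H := hGc.domRestrict.Icc_extend'
  have hHG : ∀ t ∈ Icc 0 (2 * c), H t = G t := fun t ht ↦ IccExtend_of_mem hc2 _ ht
  obtain ⟨p, hp, hvar⟩ := exists_mem_convexHull_inner_setIntegral_nonpos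
    (μ := (volume : Measure (EuclideanSpace ℝ (Fin n)))) hH hA
    (nonempty_of_measure_ne_zero hApos.ne')
  refine ⟨p, hp, ?_⟩
  have hpball : p ∈ Metric.ball q₀ c := convexHull_min hAsub (convex_ball q₀ c) hp
  have hdist : ∀ x ∈ A, ‖x - p‖ < 2 * c := fun x hx ↦ by
    have h1 := Metric.mem_ball.1 (hAsub hx)
    have h2 := Metric.mem_ball.1 hpball
    rw [← dist_eq_norm]
    linarith [dist_triangle_right x p q₀]
  have hcongr : (∫ x in A, G ‖x - p‖ • (x - p)) = ∫ x in A, H ‖x - p‖ • (x - p) :=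
    setIntegral_congr_fun hA.measurableSet fun x hx ↦ by
      simp only [hHG _ ⟨norm_nonneg _, (hdist x hx).le⟩]
  rw [hcongr]
  set V := ∫ x in A, H ‖x - p‖ • (x - p)
  have hfield : IntegrableOn (fun x ↦ H ‖x - p‖ • (x - p)) A :=
    Continuous.continuousOn (by fun_prop) |>.integrableOn_compact hA
  have hVV : inner ℝ V V ≤ 0 := by
    rw [← integral_inner hfield]
    refine setIntegral_nonpos hA.measurableSet fun x hx ↦ ?_
    rcases (norm_nonneg (x - p)).eq_or_lt with h0 | h0
    · simp [norm_eq_zero.1 h0.symm]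
    · rw [real_inner_smul_right, hHG _ ⟨h0.le, (hdist x hx).le⟩]
      exact mul_nonpos_of_nonneg_of_nonpos (hGpos _ ⟨h0, hdist x hx⟩).le
        (hvar x (subset_convexHull ℝ A hx))
  exact real_inner_self_nonpos.1 hVV
end

section
/- Let n ≥ 2 be an integer and δ > 0 a real number, and define g_δ : (0,∞) → ℝ by g_δ(r) = sinh(δr)^{−(n−1)}·∫₀^r sinh(δt)^{n−1} dt. Then the function r ↦ (n−1)·δ²·g_δ(r)²/sinh(δr)² + g_δ′(r)² is nonincreasing (antitone) on (0,∞). -/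
/-- The sign condition behind the monotonicity: a quadratic in `v` with nonpositive discriminant. -/
lemma steklov_quadratic_nonpos (m c v : ℝ) (hc : 1 ≤ c) :
    v * (1 - (m + 1) * c * v) - (1 - m * c * v) * (c * (1 - m * c * v) - v) ≤ 0 := by
  have hsq : c * (v * (1 - (m + 1) * c * v) - (1 - m * c * v) * (c * (1 - m * c * v) - v))
      = -((c - (1 + m * c ^ 2) * v) ^ 2 + v ^ 2 * (c ^ 2 - 1)) := by ring
  have hc2 : 0 ≤ c ^ 2 - 1 := by nlinarith
  refine nonpos_of_mul_nonpos_right (a := c) ?_ (by linarith)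
  rw [hsq]
  exact neg_nonpos.2 (by positivity)

/-- Monotonicity for any solution of the equation satisfied by `δ g_δ / sinh (δ r)`. -/
lemma antitoneOn_of_hasDerivAt_steklov_s16 {m δ : ℝ} (hm : 0 ≤ m) (hδ : 0 < δ) {v : ℝ → ℝ}
    (hv : ∀ r, 0 < r → HasDerivAt v
      (δ * (1 - (m + 1) * Real.cosh (δ * r) * v r) / Real.sinh (δ * r)) r) :
    AntitoneOn (fun r => m * v r ^ 2 + (1 - m * Real.cosh (δ * r) * v r) ^ 2) (Set.Ioi 0) := by
  have hderiv : ∀ r, 0 < r → HasDerivAt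
      (fun r => m * v r ^ 2 + (1 - m * Real.cosh (δ * r) * v r) ^ 2)
      (2 * m * δ / Real.sinh (δ * r) * (v r * (1 - (m + 1) * Real.cosh (δ * r) * v r)
        - (1 - m * Real.cosh (δ * r) * v r)
          * (Real.cosh (δ * r) * (1 - m * Real.cosh (δ * r) * v r) - v r))) r := by
    intro r hr
    have hS : 0 < Real.sinh (δ * r) := Real.sinh_pos_iff.2 (mul_pos hδ hr)
    have hC : HasDerivAt (fun r => Real.cosh (δ * r)) (Real.sinh (δ * r) * δ) r := by
      simpa using ((hasDerivAt_id r).const_mul δ).cosh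
    have h := (((hv r hr).pow 2).const_mul m).add
      ((((hC.const_mul m).mul (hv r hr)).const_sub 1).pow 2)
    refine h.congr_deriv ?_
    have hSC := Real.sinh_sq (δ * r)
    simp only [Pi.mul_apply]
    field_simp
    norm_num
    left
    linear_combination (-v r * (1 - m * Real.cosh (δ * r) * v r)) * hSC
  refine antitoneOn_of_deriv_nonpos (convex_Ioi 0)
    (fun r hr => (hderiv r hr).continuousAt.continuousWithinAt)
    (fun r hr => (hderiv r (by simpa using hr)).differentiableAt.differentiableWithinAt)
    fun r hr => ?_
  rw [interior_Ioi] at hr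
  rw [(hderiv r hr).deriv]
  have hS : 0 < Real.sinh (δ * r) := Real.sinh_pos_iff.2 (mul_pos hδ hr)
  exact mul_nonpos_of_nonneg_of_nonpos (by positivity)
    (steklov_quadratic_nonpos _ _ _ (Real.one_le_cosh _))

/-- Derivative of `(∫₀^r sinh(δt)^m dt) / sinh(δr)^k`. -/
lemma hasDerivAt_integral_sinh_pow_div (m k : ℕ) {δ r : ℝ} (hδ : 0 < δ) (hr : 0 < r) :
    HasDerivAt (fun r => (∫ t in (0:ℝ)..r, Real.sinh (δ * t) ^ m) / Real.sinh (δ * r) ^ k)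
      (Real.sinh (δ * r) ^ m / Real.sinh (δ * r) ^ k - k * δ * Real.cosh (δ * r) *
        (∫ t in (0:ℝ)..r, Real.sinh (δ * t) ^ m) / Real.sinh (δ * r) ^ (k + 1)) r := by
  have hS : 0 < Real.sinh (δ * r) := Real.sinh_pos_iff.2 (mul_pos hδ hr)
  have hcont : Continuous fun t => Real.sinh (δ * t) ^ m :=
    (Real.continuous_sinh.comp (continuous_const.mul continuous_id)).pow m
  have hI := hcont.integral_hasStrictDerivAt 0 r |>.hasDerivAt
  have hD : HasDerivAt (fun r => Real.sinh (δ * r)) (Real.cosh (δ * r) * δ) r := by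
    simpa using ((hasDerivAt_id r).const_mul δ).sinh
  refine (hI.div (hD.pow k) (pow_pos hS k).ne').congr_deriv ?_
  rcases k with _ | k
  · simp
  · simp only [Pi.pow_apply, Nat.add_sub_cancel]
    field_simp
    ring

/-- Let `n ≥ 2`, `δ > 0` and `g_δ(r) = sinh(δr)^{-(n-1)}·∫₀^r sinh(δt)^(n-1) dt`.
Then `r ↦ (n−1)·δ²·g_δ(r)²/sinh(δr)² + g_δ′(r)²` is nonincreasing on `(0,∞)`. -/
theorem steklov_integrand_antitoneOn_space_form (n : ℕ) (hn : 2 ≤ n) (δ : ℝ) (hδ : 0 < δ)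
    (g : ℝ → ℝ)
    (hg : ∀ r, 0 < r →
      g r = (∫ t in (0:ℝ)..r, Real.sinh (δ * t) ^ (n - 1)) / Real.sinh (δ * r) ^ (n - 1)) :
    AntitoneOn
      (fun r => ((n : ℝ) - 1) * δ ^ 2 * g r ^ 2 / Real.sinh (δ * r) ^ 2 + (deriv g r) ^ 2)
      (Set.Ioi 0) := by
  obtain ⟨m, rfl⟩ : ∃ m, n = m + 1 := ⟨n - 1, by omega⟩
  simp only [Nat.add_sub_cancel] at hg
  have hv : ∀ r, 0 < r → HasDerivAt
      (fun r => δ * ((∫ t in (0:ℝ)..r, Real.sinh (δ * t) ^ m) / Real.sinh (δ * r) ^ (m + 1)))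
      (δ * (1 - ((m : ℝ) + 1) * Real.cosh (δ * r) *
        (δ * ((∫ t in (0:ℝ)..r, Real.sinh (δ * t) ^ m) / Real.sinh (δ * r) ^ (m + 1))))
        / Real.sinh (δ * r)) r := by
    intro r hr
    have hS : 0 < Real.sinh (δ * r) := Real.sinh_pos_iff.2 (mul_pos hδ hr)
    refine ((hasDerivAt_integral_sinh_pow_div m (m + 1) hδ hr).const_mul δ).congr_deriv ?_
    push_cast
    field_simp
    ring
  refine (antitoneOn_of_hasDerivAt_steklov_s16 m.cast_nonneg hδ hv).congr fun r hr => ?_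
  have hS : 0 < Real.sinh (δ * r) := Real.sinh_pos_iff.2 (mul_pos hδ hr)
  have hgr : g =ᶠ[nhds r]
      fun r => (∫ t in (0:ℝ)..r, Real.sinh (δ * t) ^ m) / Real.sinh (δ * r) ^ m := by
    filter_upwards [Ioi_mem_nhds hr] with s hs using hg s hs
  have hd := hgr.deriv_eq.trans (hasDerivAt_integral_sinh_pow_div m m hδ hr).deriv
  simp only [hd, hg r hr]
  push_cast
  rw [div_self (pow_pos hS m).ne']
  field_simp
  ring
end
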